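/- For every integer n with 15 ≤ n ≤ 26, there exists an infinite word w : ℕ → {1,…,n} over an n-letter alphabet such that every finite factor of w having a period q ≥ 1 has length at most q·n/(n−1); that is, w contains no factor of exponent strictly greater than n/(n−1). -/

import Mathlib

/-- The factor of the infinite word `w` starting at position `i`, of length `L`. -/
def wordOf {α : Type*} (w : ℕ → α) (i L : ℕ) : List α :=
  (List.range L).map fun k => w (i + k)

/-- The finite word `u` has period `q`: `u_i = u_{i+q}` for all valid indices. -/
def HasPeriodL {α : Type*} (u : List α) (q : ℕ) : Prop :=
  ∀ i, i + q < u.length → u[i]? = u[i + q]?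

/-! ### The period-doubling word -/

/-- The period-doubling word: the parity of the 2-adic valuation of `j + 1`. -/
def periodDoubling (j : ℕ) : Bool := decide (Odd (padicValNat 2 (j + 1)))

theorem padicValNat_two_of_mod_four_eq_two {y : ℕ} (hy : y % 4 = 2) :
    padicValNat 2 y = 1 := by
  obtain ⟨z, rfl⟩ : ∃ z, y = 2 * z := ⟨y / 2, by omega⟩
  rw [padicValNat.mul (by norm_num) (by omega), padicValNat_self,
    padicValNat.eq_zero_of_not_dvd (by omega)]

theorem exists_odd_padicValNat_ne_odd_padicValNat_add (x : ℕ) {o : ℕ} (ho : Odd o) :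
    ∃ y, x ≤ y ∧ y < x + 3 ∧ y ≠ 0 ∧
      ¬ (Odd (padicValNat 2 y) ↔ Odd (padicValNat 2 (y + o))) := by
  have ho' : o % 2 = 1 := Nat.odd_iff.mp ho
  obtain ⟨y, h₁, h₂, hy⟩ : ∃ y, x ≤ y ∧ y < x + 3 ∧ (y % 4 = 2 ∨ (y + o) % 4 = 2) := by
    by_cases h : (x % 4 = 2 ∨ (x + o) % 4 = 2)
    · exact ⟨x, by omega, by omega, h⟩
    by_cases h' : ((x + 1) % 4 = 2 ∨ (x + 1 + o) % 4 = 2)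
    · exact ⟨x + 1, by omega, by omega, h'⟩
    · exact ⟨x + 2, by omega, by omega, by omega⟩
  refine ⟨y, h₁, h₂, by omega, ?_⟩
  rcases hy with hy | hy
  · rw [padicValNat_two_of_mod_four_eq_two hy,
      padicValNat.eq_zero_of_not_dvd (n := y + o) (by omega)]
    decide
  · rw [padicValNat_two_of_mod_four_eq_two hy,
      padicValNat.eq_zero_of_not_dvd (n := y) (by omega)]
    decide

/-- A repetition of period `2 ^ v * o`, `o` odd, in the period-doubling word exceeds its period
by less than `3 * 2 ^ v`. -/
theorem exists_periodDoubling_ne (a v : ℕ) {o : ℕ} (ho : Odd o) :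
    ∃ j, a ≤ j ∧ j < a + 3 * 2 ^ v ∧ periodDoubling j ≠ periodDoubling (j + 2 ^ v * o) := by
  have hpos : 0 < 2 ^ v := by positivity
  obtain ⟨y, h₁, h₂, h₀, hy⟩ := exists_odd_padicValNat_ne_odd_padicValNat_add (a / 2 ^ v + 1) ho
  have hdiv := Nat.div_add_mod a (2 ^ v)
  have hmod := Nat.mod_lt a hpos
  have hlow : 2 ^ v * (a / 2 ^ v + 1) ≤ 2 ^ v * y := Nat.mul_le_mul_left _ h₁
  have hhigh : 2 ^ v * y ≤ 2 ^ v * (a / 2 ^ v + 3) := Nat.mul_le_mul_left _ (by omega)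
  rw [mul_add] at hlow hhigh
  refine ⟨2 ^ v * y - 1, by omega, by omega, ?_⟩
  have e₁ : 2 ^ v * y - 1 + 1 = 2 ^ v * y := by omega
  have e₂ : 2 ^ v * y - 1 + 2 ^ v * o + 1 = 2 ^ v * (y + o) := by rw [mul_add]; omega
  rw [periodDoubling, periodDoubling, e₁, e₂, padicValNat.mul hpos.ne' h₀,
    padicValNat.mul hpos.ne' (by omega), padicValNat.prime_pow]
  simp only [ne_eq, decide_eq_decide, Nat.odd_add, ← Nat.not_odd_iff_even]
  tauto

/-! ### Words built from two blocks and a permutation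

The functions below that enter kernel computations are written with `Nat.rec`, `Nat.div`,
`Nat.shiftRight`, … in place of pattern matching and notation, which reduce more slowly; the
lemmas `_def`, `_zero`, `_succ` restate them in the usual notation. -/

/-- The word whose `j`-th block of length `ℓ` is the image under `C^[j]` of the block
`W (t j)`. -/
def blockWord (ℓ : ℕ) (C : ℕ → ℕ) (W : Bool → ℕ → ℕ) (t : ℕ → Bool) (i : ℕ) : ℕ :=
  C^[i.div ℓ] (W (t (i.div ℓ)) (i.mod ℓ))

theorem blockWord_def (ℓ : ℕ) (C : ℕ → ℕ) (W : Bool → ℕ → ℕ) (t : ℕ → Bool) (i : ℕ) :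
    blockWord ℓ C W t i = C^[i / ℓ] (W (t (i / ℓ)) (i % ℓ)) := rfl

/-- The `e` letters of `v` from position `i` on recur at distance `q`. -/
def Recurs (v : ℕ → ℕ) (i q e : ℕ) : Prop := ∀ k < e, v (i + k) = v (i + k + q)

/-- The word `00110`, in which every binary word of length two occurs. -/
def pilot (j : ℕ) : Bool := Nat.testBit 12 j

theorem exists_pilot_eq (a b : Bool) : ∃ p < 4, pilot p = a ∧ pilot (p + 1) = b := by
  revert a b; decide

/-- The finitely many conditions on the permutation `C` and the blocks `W false`, `W true` of
length `ℓ` under which `blockWord ℓ C W periodDoubling` has no factor of exponent greater than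
`n / (n - 1)`. Repetitions whose excess over the period is at most `K` are excluded by
inspection (`short`); for the others the colouring `col`, invariant under `C`, forces the period
to be a multiple of `ℓ` (`sync`), and even of `ℓ * M` where `M` is the least common multiple
of `ps` (`cover`). -/
structure IsDejeanBlockSystem (n ℓ K : ℕ) (C col : ℕ → ℕ) (W : Bool → ℕ → ℕ) (ps : List ℕ)
    (mark : ℕ) : Prop where
  two_le : 2 ≤ n
  window_le : n * K ≤ ℓ
  block_lt : ∀ b, ∀ r < ℓ, W b r < n
  mapsTo : ∀ x < n, C x < n
  injOn : ∀ x < n, ∀ y < n, C x = C y → x = y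
  col_apply : ∀ x < n, col (C x) = col x
  short : ∀ q < (n - 1) * K, 1 ≤ q → ∀ i, i + q + (q / (n - 1) + 1) ≤ 5 * ℓ →
    ¬ Recurs (blockWord ℓ C W pilot) i q (q / (n - 1) + 1)
  sync : ∀ q < 4 * ℓ, ¬ ℓ ∣ q → ∀ i, i + q + K ≤ 5 * ℓ →
    ¬ Recurs (fun i => col (blockWord ℓ C W pilot i)) i q K
  cover : ∀ p ∈ ps, ∀ r < ℓ, ∃ k < K, W false ((r + k) % ℓ) = W true ((r + k) % ℓ) ∧
    ∀ m, C^[m] (W false ((r + k) % ℓ)) = W false ((r + k) % ℓ) → p ∣ m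
  odd_lcm : Odd (ps.foldr Nat.lcm 1)
  le_lcm : 3 * (n - 1) ≤ ps.foldr Nat.lcm 1
  mark_lt : mark < ℓ
  mark_ne : W false mark ≠ W true mark
  mark_fixed : ∀ b, C^[ps.foldr Nat.lcm 1] (W b mark) = W b mark

theorem List.foldr_lcm_dvd {ps : List ℕ} {m : ℕ} (h : ∀ p ∈ ps, p ∣ m) :
    ps.foldr Nat.lcm 1 ∣ m := by
  induction ps with
  | nil => simp
  | cons p ps ih =>
    exact Nat.lcm_dvd (h p (by simp)) (ih fun q hq => h q (by simp [hq]))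

theorem blockWord_block_add {ℓ : ℕ} (hℓ : 0 < ℓ) (C : ℕ → ℕ) (W : Bool → ℕ → ℕ)
    (t : ℕ → Bool) (j x : ℕ) :
    blockWord ℓ C W t (j * ℓ + x) = C^[j] (blockWord ℓ C W (fun k => t (j + k)) x) := by
  have h₁ : (j * ℓ + x) / ℓ = j + x / ℓ := by
    rw [add_comm, Nat.add_mul_div_right _ _ hℓ, add_comm]
  have h₂ : (j * ℓ + x) % ℓ = x % ℓ := by
    rw [add_comm, Nat.add_mul_mod_self_right]
  rw [blockWord_def, blockWord_def, h₁, h₂, Function.iterate_add_apply]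

theorem blockWord_congr {ℓ : ℕ} (C : ℕ → ℕ) (W : Bool → ℕ → ℕ) {t t' : ℕ → Bool}
    (h₀ : t 0 = t' 0) (h₁ : t 1 = t' 1) {x : ℕ} (hx : x < 2 * ℓ) :
    blockWord ℓ C W t x = blockWord ℓ C W t' x := by
  have : x / ℓ < 2 := Nat.div_lt_of_lt_mul (by rwa [mul_comm])
  rw [blockWord_def, blockWord_def]
  interval_cases x / ℓ
  · rw [h₀]
  · rw [h₁]

namespace IsDejeanBlockSystem

variable {n ℓ K : ℕ} {C col : ℕ → ℕ} {W : Bool → ℕ → ℕ} {ps : List ℕ} {mark : ℕ}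

theorem len_pos (h : IsDejeanBlockSystem n ℓ K C col W ps mark) : 0 < ℓ :=
  (Nat.zero_le _).trans_lt h.mark_lt

theorem window_le_len (h : IsDejeanBlockSystem n ℓ K C col W ps mark) : K ≤ ℓ :=
  (Nat.le_mul_of_pos_left K (by have := h.two_le; omega)).trans h.window_le

theorem iterate_lt (h : IsDejeanBlockSystem n ℓ K C col W ps mark) (m : ℕ) {x : ℕ}
    (hx : x < n) : C^[m] x < n := by
  induction m generalizing x with
  | zero => exact hx
  | succ m ih => exact ih (h.mapsTo x hx)

theorem iterate_inj (h : IsDejeanBlockSystem n ℓ K C col W ps mark) (m : ℕ) {x y : ℕ}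
    (hx : x < n) (hy : y < n) (hxy : C^[m] x = C^[m] y) : x = y := by
  induction m generalizing x y with
  | zero => exact hxy
  | succ m ih => exact h.injOn x hx y hy (ih (h.mapsTo x hx) (h.mapsTo y hy) hxy)

theorem col_iterate (h : IsDejeanBlockSystem n ℓ K C col W ps mark) (m : ℕ) {x : ℕ}
    (hx : x < n) : col (C^[m] x) = col x := by
  induction m generalizing x with
  | zero => rfl
  | succ m ih => rw [Function.iterate_succ_apply, ih (h.mapsTo x hx), h.col_apply x hx]

theorem blockWord_lt (h : IsDejeanBlockSystem n ℓ K C col W ps mark) (t : ℕ → Bool) (i : ℕ) :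
    blockWord ℓ C W t i < n :=
  h.iterate_lt _ (h.block_lt _ _ (Nat.mod_lt _ h.len_pos))

/-- Any two consecutive blocks are, up to a power of `C`, two consecutive blocks of the
pilot word. -/
theorem exists_pilot_block (h : IsDejeanBlockSystem n ℓ K C col W ps mark) (t : ℕ → Bool)
    (j : ℕ) : ∃ p < 4, ∃ u : ℕ → ℕ, (∀ x, u x < n) ∧ ∀ x < 2 * ℓ,
      blockWord ℓ C W t (j * ℓ + x) = C^[j] (u x) ∧
      blockWord ℓ C W pilot (p * ℓ + x) = C^[p] (u x) := by
  obtain ⟨p, hp, h₀, h₁⟩ := exists_pilot_eq (t j) (t (j + 1))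
  refine ⟨p, hp, blockWord ℓ C W fun k => t (j + k), h.blockWord_lt _, fun x hx =>
    ⟨blockWord_block_add h.len_pos .., ?_⟩⟩
  rw [blockWord_block_add h.len_pos]
  congr 1
  exact blockWord_congr C W (by simpa using h₀) (by simpa using h₁) hx

theorem not_recurs_of_lt (h : IsDejeanBlockSystem n ℓ K C col W ps mark) (t : ℕ → Bool)
    {i q : ℕ} (hq : 1 ≤ q) (hqK : q < (n - 1) * K) :
    ¬ Recurs (blockWord ℓ C W t) i q (q / (n - 1) + 1) := by
  intro hrec
  obtain ⟨p, hp, u, hu, hpu⟩ := h.exists_pilot_block t (i / ℓ)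
  have hr := Nat.mod_lt i h.len_pos
  have hi := Nat.div_add_mod' i ℓ
  have hwin := h.window_le
  have he : q / (n - 1) < K := Nat.div_lt_of_lt_mul hqK
  have hnK : (n - 1) * K + K = n * K := by
    obtain ⟨c, rfl⟩ : ∃ c, n = c + 1 := ⟨n - 1, by have := h.two_le; omega⟩
    simp [add_mul]
  have hpℓ : p * ℓ ≤ 3 * ℓ := Nat.mul_le_mul_right _ (by omega)
  refine h.short q hqK hq (p * ℓ + i % ℓ) (by omega) fun k hk => ?_
  have e₁ := hpu (i % ℓ + k) (by omega)
  have e₂ := hpu (i % ℓ + k + q) (by omega)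
  have hik := hrec k hk
  rw [show i + k = i / ℓ * ℓ + (i % ℓ + k) by omega, e₁.1,
    show i / ℓ * ℓ + (i % ℓ + k) + q = i / ℓ * ℓ + (i % ℓ + k + q) by omega, e₂.1] at hik
  rw [show p * ℓ + i % ℓ + k = p * ℓ + (i % ℓ + k) by omega, e₁.2,
    show p * ℓ + (i % ℓ + k) + q = p * ℓ + (i % ℓ + k + q) by omega, e₂.2,
    h.iterate_inj _ (hu _) (hu _) hik]

theorem len_dvd_of_recurs (h : IsDejeanBlockSystem n ℓ K C col W ps mark) (t : ℕ → Bool)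
    {i q : ℕ} (hrec : Recurs (blockWord ℓ C W t) i q K) : ℓ ∣ q := by
  have hcol : ∀ i, ∃ p < 4, ∀ k < K, col (blockWord ℓ C W t (i + k)) =
      col (blockWord ℓ C W pilot (p * ℓ + i % ℓ + k)) := by
    intro i
    obtain ⟨p, hp, u, hu, hpu⟩ := h.exists_pilot_block t (i / ℓ)
    have hr := Nat.mod_lt i h.len_pos
    have hi := Nat.div_add_mod' i ℓ
    have hK := h.window_le_len
    refine ⟨p, hp, fun k hk => ?_⟩
    have e := hpu (i % ℓ + k) (by omega)
    rw [show i + k = i / ℓ * ℓ + (i % ℓ + k) by omega, e.1, add_assoc, e.2,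
      h.col_iterate _ (hu _), h.col_iterate _ (hu _)]
  have hsync : ∀ p p' r r', p < 4 → p' < 4 → r < ℓ → r' < ℓ → r ≠ r' →
      p * ℓ + r ≤ p' * ℓ + r' →
      ¬ ∀ k < K, col (blockWord ℓ C W pilot (p * ℓ + r + k)) =
        col (blockWord ℓ C W pilot (p' * ℓ + r' + k)) := by
    intro p p' r r' hp hp' hr hr' hne hle hall
    have hpℓ : p' * ℓ ≤ 3 * ℓ := Nat.mul_le_mul_right _ (by omega)
    have hK := h.window_le_len
    refine h.sync (p' * ℓ + r' - (p * ℓ + r)) (by omega) (fun hd => hne ?_) (p * ℓ + r)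
      (by omega) fun k hk => ?_
    · have hm := (Nat.modEq_iff_dvd' hle).mpr hd
      simpa [Nat.ModEq, Nat.add_mod, Nat.mod_eq_of_lt hr, Nat.mod_eq_of_lt hr'] using hm
    · rw [show p * ℓ + r + k + (p' * ℓ + r' - (p * ℓ + r)) = p' * ℓ + r' + k by omega]
      exact hall k hk
  obtain ⟨p, hp, e⟩ := hcol i
  obtain ⟨p', hp', e'⟩ := hcol (i + q)
  have hall : ∀ k < K, col (blockWord ℓ C W pilot (p * ℓ + i % ℓ + k)) =
      col (blockWord ℓ C W pilot (p' * ℓ + (i + q) % ℓ + k)) := fun k hk => by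
    rw [← e k hk, ← e' k hk, hrec k hk, add_right_comm]
  have hr := Nat.mod_lt i h.len_pos
  have hr' := Nat.mod_lt (i + q) h.len_pos
  have hmod : i % ℓ = (i + q) % ℓ := by
    by_contra hne
    rcases le_total (p * ℓ + i % ℓ) (p' * ℓ + (i + q) % ℓ) with hle | hle
    · exact hsync p p' _ _ hp hp' hr hr' hne hle hall
    · exact hsync p' p _ _ hp' hp hr' hr (Ne.symm hne) hle fun k hk => (hall k hk).symm
  simpa using (Nat.modEq_iff_dvd' (Nat.le_add_right i q)).mp hmod

theorem eq_iterate_of_blockWord_eq (h : IsDejeanBlockSystem n ℓ K C col W ps mark)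
    (t : ℕ → Bool) {i m : ℕ} (heq : blockWord ℓ C W t i = blockWord ℓ C W t (i + ℓ * m)) :
    W (t (i / ℓ)) (i % ℓ) = C^[m] (W (t (i / ℓ + m)) (i % ℓ)) := by
  have hr := Nat.mod_lt i h.len_pos
  rw [blockWord_def, blockWord_def, Nat.add_mul_div_left _ _ h.len_pos, Nat.add_mul_mod_self_left,
    Function.iterate_add_apply] at heq
  exact h.iterate_inj _ (h.block_lt _ _ hr) (h.iterate_lt _ (h.block_lt _ _ hr)) heq

theorem lcm_dvd_of_recurs (h : IsDejeanBlockSystem n ℓ K C col W ps mark) (t : ℕ → Bool)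
    {i m : ℕ} (hrec : Recurs (blockWord ℓ C W t) i (ℓ * m) K) : ps.foldr Nat.lcm 1 ∣ m := by
  refine List.foldr_lcm_dvd fun p hp => ?_
  obtain ⟨k, hk, hcommon, hper⟩ := h.cover p hp (i % ℓ) (Nat.mod_lt _ h.len_pos)
  rw [Nat.mod_add_mod] at hcommon hper
  have hW : ∀ b, W b ((i + k) % ℓ) = W false ((i + k) % ℓ) := by
    rintro (_ | _)
    · rfl
    · exact hcommon.symm
  have e := h.eq_iterate_of_blockWord_eq t (hrec k hk)
  rw [hW (t ((i + k) / ℓ)), hW (t ((i + k) / ℓ + m))] at e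
  exact hper m e.symm

/-- In `blockWord ℓ C W periodDoubling` a factor of period `q` has length at most
`q + q / (n - 1)`. -/
theorem excess_le (h : IsDejeanBlockSystem n ℓ K C col W ps mark) {i q e : ℕ} (hq : 1 ≤ q)
    (hrec : Recurs (blockWord ℓ C W periodDoubling) i q e) : (n - 1) * e ≤ q := by
  by_contra! hlt
  have hn : 0 < n - 1 := by have := h.two_le; omega
  have hqe : q / (n - 1) < e := Nat.div_lt_of_lt_mul hlt
  by_cases hqK : q < (n - 1) * K
  · exact h.not_recurs_of_lt _ hq hqK fun k hk => hrec k (by omega)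
  have hKe : K ≤ e := by
    have := (Nat.le_div_iff_mul_le (x := K) (y := q) hn).mpr (by rw [mul_comm]; omega)
    omega
  have hrecK : Recurs (blockWord ℓ C W periodDoubling) i q K :=
    fun k hk => hrec k (by omega)
  obtain ⟨m, rfl⟩ := h.len_dvd_of_recurs _ hrecK
  have hM := h.lcm_dvd_of_recurs _ hrecK
  have hm : m ≠ 0 := by rintro rfl; omega
  obtain ⟨v, o, ho, hmo⟩ := Nat.exists_eq_two_pow_mul_odd hm
  have hMo : ps.foldr Nat.lcm 1 ∣ o :=
    Nat.Coprime.dvd_of_dvd_mul_left (Nat.Coprime.pow_right v h.odd_lcm.coprime_two_right)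
      (hmo ▸ hM)
  have hle : 3 * (n - 1) ≤ o := h.le_lcm.trans (Nat.le_of_dvd ho.pos hMo)
  have hlong : ℓ * (3 * 2 ^ v) < e := by
    refine Nat.lt_of_mul_lt_mul_left (a := n - 1) (lt_of_le_of_lt ?_ hlt)
    calc (n - 1) * (ℓ * (3 * 2 ^ v)) = ℓ * (2 ^ v * (3 * (n - 1))) := by ring
      _ ≤ ℓ * m := by rw [hmo]; gcongr
  obtain ⟨j, hj₁, hj₂, hj⟩ := exists_periodDoubling_ne ((i + (ℓ - 1 - mark)) / ℓ) v ho
  have hmark := h.mark_lt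
  have hdiv := Nat.div_add_mod (i + (ℓ - 1 - mark)) ℓ
  have hmod := Nat.mod_lt (i + (ℓ - 1 - mark)) h.len_pos
  have hlow := Nat.mul_le_mul_left ℓ hj₁
  have hhigh := Nat.mul_le_mul_left ℓ (Nat.succ_le_of_lt hj₂)
  rw [mul_add] at hhigh
  rw [Nat.succ_eq_add_one, mul_add] at hhigh
  have heq := hrec (ℓ * j + mark - i) (by omega)
  rw [show i + (ℓ * j + mark - i) = ℓ * j + mark by omega] at heq
  have hW := h.eq_iterate_of_blockWord_eq _ heq
  rw [Nat.mul_add_div h.len_pos, Nat.mul_add_mod, Nat.div_eq_of_lt hmark,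
    Nat.mod_eq_of_lt hmark, add_zero] at hW
  have hfix : ∀ b, C^[m] (W b mark) = W b mark := fun b => by
    obtain ⟨c, rfl⟩ := hM
    exact (show Function.IsPeriodicPt C _ _ from h.mark_fixed b).mul_const c
  rw [hfix, hmo] at hW
  have hne := h.mark_ne
  generalize periodDoubling j = a at hW hj
  generalize periodDoubling (j + 2 ^ v * o) = b at hW hj
  cases a <;> cases b <;> simp_all

end IsDejeanBlockSystem

/-! ### Bit-parallel search for repetitions -/

/-- The letters `v o, …, v (o + 2 ^ k - 1)` as consecutive groups of five bits. -/
def pack (v : ℕ → ℕ) (k : ℕ) : ℕ → ℕ :=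
  Nat.rec v (fun k ih o =>
    (ih o).lor ((ih (o.add (Nat.pow 2 k))).shiftLeft (Nat.mul 5 (Nat.pow 2 k)))) k

theorem pack_zero (v : ℕ → ℕ) (o : ℕ) : pack v 0 o = v o := rfl

theorem pack_succ (v : ℕ → ℕ) (k o : ℕ) :
    pack v (k + 1) o = pack v k o ||| pack v k (o + 2 ^ k) <<< (5 * 2 ^ k) := rfl

theorem testBit_pack {v : ℕ → ℕ} (hv : ∀ i, v i < 32) {b : ℕ} (hb : b < 5) (k o i : ℕ) :
    (pack v k o).testBit (5 * i + b) = (decide (i < 2 ^ k) && (v (o + i)).testBit b) := by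
  induction k generalizing o i with
  | zero =>
    rcases Nat.eq_zero_or_pos i with rfl | hi
    · simp [pack_zero]
    · rw [pack_zero, Nat.testBit_lt_two_pow ((hv o).trans_le (Nat.pow_le_pow_right (n := 2)
        (i := 5) (by norm_num) (by omega)))]
      simp [hi.ne']
  | succ k ih =>
    have hp : 2 ^ (k + 1) = 2 ^ k + 2 ^ k := by ring
    rw [pack_succ, Nat.testBit_or, Nat.testBit_shiftLeft, ih, hp]
    by_cases hi : i < 2 ^ k
    · have h₁ : ¬ 5 * 2 ^ k ≤ 5 * i + b := by omega
      have h₂ : i < 2 ^ k + 2 ^ k := by omega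
      simp [hi, h₁, h₂]
    · have h₁ : 5 * 2 ^ k ≤ 5 * i + b := by omega
      have h₂ : i - 2 ^ k < 2 ^ k ↔ i < 2 ^ k + 2 ^ k := by omega
      rw [show 5 * i + b - 5 * 2 ^ k = 5 * (i - 2 ^ k) + b by omega, ih,
        show o + 2 ^ k + (i - 2 ^ k) = o + i by omega]
      simp [hi, h₁, h₂]

/-- The bitwise disjunction of the five bits of each group, stored in its lowest bit. -/
def foldGroups (Y : ℕ) : ℕ :=
  (((Y.lor (Y.shiftRight 1)).lor (Y.shiftRight 2)).lor (Y.shiftRight 3)).lor (Y.shiftRight 4)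

theorem foldGroups_def (Y : ℕ) :
    foldGroups Y = Y ||| Y >>> 1 ||| Y >>> 2 ||| Y >>> 3 ||| Y >>> 4 := rfl

/-- Given a packed word `X` and the mask `ones` of its valid positions, the mask of the positions
where `X` agrees with its shift by `q`. -/
def agreement (X ones q : ℕ) : ℕ :=
  (ones.shiftRight (Nat.mul 5 q)).xor
    ((ones.shiftRight (Nat.mul 5 q)).land (foldGroups (X.xor (X.shiftRight (Nat.mul 5 q)))))

theorem agreement_def (X ones q : ℕ) : agreement X ones q =
    ones >>> (5 * q) ^^^ (ones >>> (5 * q) &&& foldGroups (X ^^^ X >>> (5 * q))) := rfl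

/-- No `e + 1` consecutive groups of `P` have their lowest bits set. -/
def noRun (e : ℕ) : ℕ → Bool :=
  Nat.rec (fun P => P.beq 0) (fun _ ih P => P.beq 0 || ih (P.land (P.shiftRight 5))) e

theorem noRun_succ (e P : ℕ) :
    noRun (e + 1) P = (P.beq 0 || noRun e (P &&& P >>> 5)) := rfl

theorem exists_testBit_eq_false_of_noRun {e P : ℕ} (h : noRun e P = true) (i : ℕ) :
    ∃ k ≤ e, P.testBit (5 * (i + k)) = false := by
  induction e generalizing P with
  | zero => exact ⟨0, le_rfl, by simp [Nat.eq_of_beq_eq_true h]⟩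
  | succ e ih =>
    rw [noRun_succ, Bool.or_eq_true] at h
    rcases h with h | h
    · exact ⟨0, Nat.zero_le _, by simp [Nat.eq_of_beq_eq_true h]⟩
    · obtain ⟨k, hk, hbit⟩ := ih h
      rw [Nat.testBit_and, Nat.testBit_shiftRight, Bool.and_eq_false_iff] at hbit
      rcases hbit with hbit | hbit
      · exact ⟨k, by omega, hbit⟩
      · exact ⟨k + 1, by omega, by rw [← hbit]; congr 1; ring⟩

theorem testBit_foldGroups_xor {v : ℕ → ℕ} (hv : ∀ i, v i < 32) {k i q : ℕ}
    (hi : i + q < 2 ^ k) (heq : v i = v (i + q)) :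
    (foldGroups (pack v k 0 ^^^ pack v k 0 >>> (5 * q))).testBit (5 * i) = false := by
  have hbit : ∀ b < 5,
      (pack v k 0 ^^^ pack v k 0 >>> (5 * q)).testBit (5 * i + b) = false := by
    intro b hb
    have hlt : i < 2 ^ k := by omega
    rw [Nat.testBit_xor, Nat.testBit_shiftRight,
      show 5 * q + (5 * i + b) = 5 * (i + q) + b by ring, testBit_pack hv hb,
      testBit_pack hv hb]
    simp [hi, hlt, heq]
  have h₀ := hbit 0 (by norm_num)
  have h₁ := hbit 1 (by norm_num)
  have h₂ := hbit 2 (by norm_num)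
  have h₃ := hbit 3 (by norm_num)
  have h₄ := hbit 4 (by norm_num)
  rw [add_zero] at h₀
  rw [foldGroups_def]
  generalize pack v k 0 ^^^ pack v k 0 >>> (5 * q) = Y at *
  simp only [Nat.testBit_or, Nat.testBit_shiftRight, add_comm _ (5 * i), h₀, h₁, h₂, h₃, h₄,
    Bool.or_self]

/-- Soundness of the bit-parallel search in the first `N` letters of `v`. -/
theorem not_recurs_of_noRun {v : ℕ → ℕ} (hv : ∀ i, v i < 32) {k N q e : ℕ} (hN : N ≤ 2 ^ k)
    (h : noRun e (agreement (pack v k 0) (pack (fun i => cond (i.blt N) 1 0) k 0) q) = true)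
    {i : ℕ} (hi : i + q + (e + 1) ≤ N) : ¬ Recurs v i q (e + 1) := by
  intro hrec
  obtain ⟨j, hj, hbit⟩ := exists_testBit_eq_false_of_noRun h i
  have hones : (pack (fun i => cond (i.blt N) 1 0) k 0).testBit (5 * (q + (i + j))) = true := by
    have := testBit_pack (v := fun i => cond (i.blt N) 1 0)
      (fun i => by cases i.blt N <;> norm_num) (b := 0) (by norm_num) k 0 (q + (i + j))
    rw [add_zero] at this
    rw [this]
    have h₁ : q + (i + j) < 2 ^ k := by omega
    have h₂ : (q + (i + j)).blt N = true := Nat.blt_eq.mpr (by omega)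
    simp [h₁, h₂]
  rw [agreement_def, Nat.testBit_xor, Nat.testBit_and, Nat.testBit_shiftRight, ← mul_add, hones,
    testBit_foldGroups_xor hv (by omega) (hrec j (by omega))] at hbit
  simp at hbit

/-! ### Numerical block systems -/

/-- The `i`-th digit of `X` in base `32`. -/
def digit (X i : ℕ) : ℕ := (X.shiftRight (Nat.mul 5 i)).mod 32

theorem digit_lt (X i : ℕ) : digit X i < 32 := Nat.mod_lt _ (by norm_num)

/-- A permutation, the lengths of its cycles and two blocks, all given by their digits in
base `32`. -/
structure BlockData where
  /-- The common length of the blocks. -/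
  len : ℕ
  /-- The length of a factor that determines its position modulo `len`. -/
  window : ℕ
  /-- The table of the permutation. -/
  perm : ℕ
  /-- The table of the lengths of the cycles through the letters. -/
  period : ℕ
  /-- The lengths of the cycles met by every window. -/
  cycles : List ℕ
  /-- A position where the two blocks differ. -/
  mark : ℕ
  /-- The first block. -/
  block₀ : ℕ
  /-- The second block. -/
  block₁ : ℕ

namespace BlockData

variable (D : BlockData)

/-- The blocks as words. -/
def letter (b : Bool) (r : ℕ) : ℕ := digit (cond b D.block₁ D.block₀) r

/-- The pilot word of the system. -/
def pilotWord : ℕ → ℕ := blockWord D.len (digit D.perm) D.letter pilot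

/-- The word of the cycle lengths of the letters of the pilot word. -/
def pilotColor (i : ℕ) : ℕ := digit D.period (D.pilotWord i)

/-- The mask of the positions of the pilot word. -/
def pilotMask : ℕ := pack (fun i => cond (i.blt (5 * D.len)) 1 0) 12 0

/-- No short repetition in the pilot word packed as `X`. -/
def checkShort (n X ones : ℕ) : Bool :=
  (List.range ((n - 1) * D.window)).all fun q =>
    Nat.beq q 0 || noRun (q / (n - 1)) (agreement X ones q)

/-- In the colouring packed as `X`, a window determines its position modulo `len`. -/
def checkSync (X ones : ℕ) : Bool :=
  (List.range (4 * D.len)).all fun q =>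
    Nat.beq (q % D.len) 0 || noRun (D.window - 1) (agreement X ones q)

/-- The blocks are words over `n` letters, and every window meets the chosen cycles. -/
def checkLetters (n : ℕ) : Bool :=
  (List.range D.len).all fun r =>
    Nat.blt (D.letter false r) n && Nat.blt (D.letter true r) n &&
      D.cycles.all fun p => (List.range D.window).any fun k =>
        Nat.beq (D.letter false ((r + k) % D.len)) (D.letter true ((r + k) % D.len)) &&
          Nat.beq (digit D.period (D.letter false ((r + k) % D.len))) p

/-- The table `perm` is a permutation of `n` letters with cycle lengths `period`. -/
def checkPerm (n : ℕ) : Bool :=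
  (List.range n).all fun x =>
    Nat.blt (digit D.perm x) n &&
      Nat.beq (digit D.period (digit D.perm x)) (digit D.period x) &&
      Nat.blt 0 (digit D.period x) &&
      Nat.beq ((digit D.perm)^[digit D.period x] x) x &&
      ((List.range (digit D.period x)).all fun d =>
        Nat.beq d 0 || !Nat.beq ((digit D.perm)^[d] x) x) &&
      (List.range n).all fun y =>
        Nat.beq x y || !Nat.beq (digit D.perm x) (digit D.perm y)

/-- The numerical conditions on the lengths, the cycles and the mark. -/
def checkSize (n : ℕ) : Bool :=
  Nat.ble 2 n && Nat.blt 0 D.window && Nat.ble (n * D.window) D.len &&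
    Nat.ble (5 * D.len) (2 ^ 12) &&
    Nat.beq (D.cycles.foldr Nat.lcm 1 % 2) 1 &&
    Nat.ble (3 * (n - 1)) (D.cycles.foldr Nat.lcm 1) && Nat.blt D.mark D.len &&
    !Nat.beq (D.letter false D.mark) (D.letter true D.mark) &&
    Nat.beq ((digit D.perm)^[D.cycles.foldr Nat.lcm 1] (D.letter false D.mark))
      (D.letter false D.mark) &&
    Nat.beq ((digit D.perm)^[D.cycles.foldr Nat.lcm 1] (D.letter true D.mark))
      (D.letter true D.mark)

/-- The decision procedure for the conditions in `IsDejeanBlockSystem`. -/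
def check (n : ℕ) : Bool :=
  D.checkSize n && D.checkPerm n && D.checkLetters n &&
    D.checkShort n (pack D.pilotWord 12 0) D.pilotMask &&
    D.checkSync (pack D.pilotColor 12 0) D.pilotMask

variable {D}

theorem pilotWord_lt (i : ℕ) : D.pilotWord i < 32 := by
  rw [pilotWord, blockWord_def]
  cases i / D.len with
  | zero => exact digit_lt _ _
  | succ m => rw [Function.iterate_succ_apply']; exact digit_lt _ _

theorem isDejeanBlockSystem_of_check {n : ℕ} (h : D.check n = true) :
    IsDejeanBlockSystem n D.len D.window (digit D.perm) (digit D.period) D.letter D.cycles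
      D.mark := by
  simp only [check, checkSize, checkPerm, checkLetters, checkShort, checkSync, Bool.and_eq_true,
    Bool.or_eq_true, List.all_eq_true, List.any_eq_true, List.mem_range, Nat.beq_eq,
    Nat.ble_eq, Nat.blt_eq, Bool.not_eq_true', Bool.eq_false_iff, ne_eq] at h
  obtain ⟨⟨⟨⟨⟨⟨⟨⟨⟨⟨⟨⟨⟨h2, hK⟩, hwin⟩, hlen⟩, hodd⟩, hle⟩, hmark⟩, hne⟩, hfix₀⟩, hfix₁⟩,
    hperm⟩, hletters⟩, hshort⟩, hsync⟩ := h
  have hlt : ∀ b, ∀ r < D.len, D.letter b r < n := fun b r hr => by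
    cases b
    · exact (hletters r hr).1.1
    · exact (hletters r hr).1.2
  refine
    { two_le := h2
      window_le := hwin
      block_lt := hlt
      mapsTo := fun x hx => (hperm x hx).1.1.1.1.1
      injOn := fun x hx y hy hxy =>
        ((hperm x hx).2 y hy).resolve_right fun hn => hn hxy
      col_apply := fun x hx => (hperm x hx).1.1.1.1.2
      short := fun q hq hq₁ i hi =>
        not_recurs_of_noRun pilotWord_lt hlen
          ((hshort q hq).resolve_left (by omega)) hi
      sync := fun q hq hd i hi => ?_
      cover := fun p hp r hr => ?_
      odd_lcm := Nat.odd_iff.mpr hodd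
      le_lcm := hle
      mark_lt := hmark
      mark_ne := hne
      mark_fixed := fun b => by cases b; exacts [hfix₀, hfix₁] }
  · have hrun := (hsync q hq).resolve_left fun h0 => hd (Nat.dvd_of_mod_eq_zero h0)
    have hnot := not_recurs_of_noRun (v := D.pilotColor) (fun _ => digit_lt _ _) hlen hrun
      (i := i) (by omega)
    rwa [Nat.sub_add_cancel hK] at hnot
  · obtain ⟨k, hk, hcommon, hper⟩ := (hletters r hr).2 p hp
    refine ⟨k, hk, hcommon, fun m hm => ?_⟩
    obtain ⟨⟨⟨⟨-, hp0⟩, hcycle⟩, hmin⟩, -⟩ :=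
      hperm _ (hlt false ((r + k) % D.len) (Nat.mod_lt _ ((Nat.zero_le _).trans_lt hr)))
    rw [hper] at hp0 hcycle hmin
    have hmod := Function.IsPeriodicPt.mod hm hcycle
    exact Nat.dvd_of_mod_eq_zero
      ((hmin (m % p) (Nat.mod_lt _ hp0)).resolve_right fun hn => hn hmod)

/-- A certified block system yields an infinite word without factors of exponent greater than
`n / (n - 1)`. -/
theorem exists_word_of_check {n : ℕ} (h : D.check n = true) :
    ∃ w : ℕ → Fin n, ∀ i L q : ℕ, 1 ≤ q → HasPeriodL (wordOf w i L) q →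
      (L : ℚ) ≤ (q : ℚ) * n / (n - 1) := by
  have hD := isDejeanBlockSystem_of_check h
  refine ⟨fun i => ⟨_, hD.blockWord_lt periodDoubling i⟩, fun i L q hq hper => ?_⟩
  have hn := hD.two_le
  have hexc : (n - 1) * (L - q) ≤ q := by
    refine hD.excess_le (i := i) hq fun k hk => ?_
    have hkL : k + q < L := by omega
    have := hper k (by simpa [wordOf] using hkL)
    simpa [wordOf, hkL, show k < L by omega, add_assoc] using this
  obtain ⟨c, rfl⟩ : ∃ c, n = c + 2 := ⟨n - 2, by omega⟩
  have hmul : L * (c + 1) ≤ q * (c + 2) := by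
    rcases le_total L q with hLq | hLq
    · exact Nat.mul_le_mul hLq (by omega)
    · obtain ⟨e, rfl⟩ := Nat.exists_eq_add_of_le hLq
      rw [Nat.add_sub_cancel_left] at hexc
      simp only [Nat.add_succ_sub_one] at hexc
      nlinarith
  have hpos : (0 : ℚ) < ((c + 2 : ℕ) : ℚ) - 1 := by push_cast; linarith [c.cast_nonneg (α := ℚ)]
  rw [le_div_iff₀ hpos]
  have hcast : ((L * (c + 1) : ℕ) : ℚ) ≤ ((q * (c + 2) : ℕ) : ℚ) := by exact_mod_cast hmul
  push_cast at hcast ⊢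
  linarith

end BlockData

/-- A block system over 15 letters. -/
def blockData15 : BlockData where
  len := 259
  window := 16
  perm := 7093135012837899476130
  period := 10820503039744314217765
  cycles := [5, 9]
  mark := 47
  block₀ := 133228322462045308255156727889805354115800142218422562263248834269291610086280472299842378682143635817647496184505868685669121595766242772531960794689589654838144799374930884788841681884393531024424197195915005047350243628774882166504055358915085060490033280678397835823950351478998342816494009951453071718953198740704118460363487716000921911223251313069474645674451972005835302184627046432
  block₁ := 133228322462045308255156727889805354115800142218422562263248834269291610086280472299842378682143635817647496184505868685669121595766242743012410580721523393358636935350914325535005087806678744704235040799582111664516689531761632935539158603487863635182910672425580872618895066805092692744416374387392096399117117683072498504649287231942463525015203761741743002005268270948995146676818774048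

theorem check_blockData15 : blockData15.check 15 = true := by decide +kernel

/-- A block system over 16 letters. -/
def blockData16 : BlockData where
  len := 282
  window := 13
  perm := 342416939428385137993934
  period := 350825989889959899735209
  cycles := [5, 9]
  mark := 48
  block₀ := 7998382147643267335682822075559058462680754517218698783183308394447798659813713046202867766266925095039587670953601030830057434051233357926112967122237579239861620199240049498370224489469020546821645860593279314661816967828594592470824406932584788261569096483521289051250927045884094058592435386169163075274387971960735762122493775568149243468396474923937691182091882752124851956647840894280755400481055104528303697587963936
  block₁ := 7998382147643267335682822075559058462680754517218698783183308394447798659813713046202867766266925095039587670953601030830057434051233357926112967122237561839160500918265997767731936261871309953786659578659232645293850480186149372947403727228404181541068725356651796766749010678772690489127224478616248027595892904154802263299224364995777292612500165103672699644411421609824604694898574082605874486116751590104190717314304032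

theorem check_blockData16 : blockData16.check 16 = true := by decide +kernel

/-- A block system over 17 letters. -/
def blockData17 : BlockData where
  len := 249
  window := 11
  perm := 12295902159161191807856928
  period := 8579623515055297215501537
  cycles := [3, 5, 7]
  mark := 53
  block₀ := 198287715117358455053436619094651133611438185917739629930868741775809069104617573321538539361033371833143651546675477604153683325741215968835965464594836786688116527397841202457863672710475950964671242944213481842105140519462252793152857261964812620998051804401910919107162551582970081182714002370040936691903602329147089075820758940771603262060487576583607286856841546532896
  block₁ := 198287715117358455053436619094651133611438185917739629930868741775809069104617573321537912434704757599804375883021945628574827618313650852187720892926282470236180893061396711069516317826468851950416091856645168558089539759105119264445898077621402328603471326036916928021079338337292878665872450617504836814980324878694848833459458537888852260220792097212192734362101992228896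

theorem check_blockData17 : blockData17.check 17 = true := by decide +kernel

/-- A block system over 18 letters. -/
def blockData18 : BlockData where
  len := 312
  window := 13
  perm := 243112793785754750535575621
  period := 273487857078400656103148645
  cycles := [3, 5, 7]
  mark := 49
  block₀ := 7942675253819530562142042434632751430009459590015218308500864161410489374479709710452524374167937798403566262659363650137161831253753037382911431396017197916883111038085256791636614517236639400387371010135594692178246571137677077524094669548700070544493451320846139456564592816189322626446662989839759981717036316032546584930980428105479948622679269722076791591393852234774671604319996873420904079109008994901524941282789258018773513549423651129709580635011390944413728
  block₁ := 7942675253819530562142042434632751430009459590015218308500864161410489374479709710452524374167937798403566262659363650137161831253753037382911431369975697064111456772517618166833902307552941171965739191307304408754629900504027870844415076991143564975431416208353387091710887241642147839413243039615728173076261317206258777702848459546166838683961555427788788345631732748776019567339925551910799315745176192119185316176189103049269874686344572964588719551708067329574944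

theorem check_blockData18 : blockData18.check 18 = true := by decide +kernel

/-- A block system over 19 letters. -/
def blockData19 : BlockData where
  len := 319
  window := 12
  perm := 11538425043502199473789027373
  period := 8867592602063437969684075555
  cycles := [3, 5, 7]
  mark := 50
  block₀ := 404829604967325010610433915991217022177131199249086943891792804295929334840285909827654745243679475563707256932351807359236481589586783680300028531140919951426833799164876106908066081824724373773945012791812700989360435479484871194861391493641728159313563671783780321704453584729381853850478385431831437022565959720609925638028059503527993872490133407803152482096525227202606064104085676369437569832199979825124592201205011521896958455397909285694476213888567924327058095059601440
  block₁ := 404829604967325010610433915991217022177131199249086943891792804295929334840285909827654745243679475563707256932351807359236481589586783680300027695732992644892561059622652889089037736350263023160988469124972537914072126278390738228568605735713826857016335066267339397809064531880135714770859634974761513402487128375785429180185449868699883457530718877910718261609481504940646149125459653523734927966248537836749988762844807624765798295591858989798896166825448401180049858564818976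

theorem check_blockData19 : blockData19.check 19 = true := by decide +kernel

/-- A block system over 20 letters. -/
def blockData20 : BlockData where
  len := 284
  window := 11
  perm := 436085516350808295243929339974
  period := 90648931117734897754068722985
  cycles := [7, 9]
  mark := 56
  block₀ := 10200340993367391439951709011591790011322114788476913753025338951119337674251473188756696913395499449185475539777885524446038446292409770687007147827687309931073508089726366080575210742162908089867404515653441159265283210744534134884559220776799770933157318498741493218055952425681031682240314832374695669520740469187907017010088973910671996124999726127856713033888486145215598113319296650488105939211766158648405525506602141728
  block₁ := 10200340993367391439951709011591790011322114788476913753025338951119337674251473188756696913395499449185475539777885524446038291237580265939847364490164097462341769696695630194659412607643798023783881480231119282763704946160979265655400582841418880547125607687856189821012267315945982301186904591454626548164125635253310541529239918620941308779640750154998355869277194017147640821753031041746369226708535429770793654853587535904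

theorem check_blockData20 : blockData20.check 20 = true := by decide +kernel

/-- A block system over 21 letters. -/
def blockData21 : BlockData where
  len := 329
  window := 12
  perm := 15771752910681153632103098863110
  period := 2900775542473752586115427116327
  cycles := [7, 9]
  mark := 54
  block₀ := 608515139319852248997952362314031692399513242488732555605760467555451464935996292841686185743481812449978396970572750054817366819445737466570395774129784368519011168017317877052411587973374323383953195617681631054395151234300094549077239192037288180243035120507832744317623555008604652623822954357734978957494457994633687919212766512365340554932783308940266934716815203761629240189369942995225914444437125581363265742826234926884184821930424127737009614256860023838454007508764422142602579642400
  block₁ := 608515139319852248997952362314031692399513242488732555605760467555451464935996292841686185743481812449978396970572750054817365735024248329368008816187002601952834107957232950825778485404348356355420651158259924991103987391228762593480067355387068204398599982386876949995509953612077592296610872400973384163817107399375442334499139650159270000142768989484969512233463755681497273228272292496215840761788637586423378793662887760174424140978818135909426661993938960790363698345384529581209980864544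

theorem check_blockData21 : blockData21.check 21 = true := by decide +kernel

/-- A block system over 22 letters. -/
def blockData22 : BlockData where
  len := 364
  window := 14
  perm := 177831759388491494307275441027562
  period := 460525187089615141485471620965739
  cycles := [9, 11]
  mark := 63
  block₀ := 10051576202173157844666529423145601761128021256586180559926214908658078437346739358130088925470320758795980432255144702294329324746009379496817589540177510622451054884672213181898268092402730297447908449480305430550218235632845457114191420518769993763545459509389654175359669490825700580188643717091167688009839290869482318701333981648101288895534288351675163536820551963074793766473281930078709403608805993226548554780253369541293775230948169537486584707201675529359300624542233058634214572099320844000622327237236391240538735202827863603581913120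
  block₁ := 10051576202173157844666529423145601761128021256586180559926214908658078437346739358130088925470320758795980432255144702294329324746009379496817589540180325434410931892047244684517792550706015952703454066305055332292914718153349933955285636733411303491940916873146131953221521852479856589313206093172333503355113375377150367504409348989271829696163878797499960639836134251322919793046754644640579749425407144945555790419653020914762684489231341884077418305945230294002956351769301927631517939837961244407639529956483268895777956786425841061655054368

theorem check_blockData22 : blockData22.check 22 = true := by decide +kernel

/-- A block system over 23 letters. -/
def blockData23 : BlockData where
  len := 351
  window := 15
  perm := 14403864444943617272470679294486948
  period := 17419318333570743377366110826837289
  cycles := [9, 13]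
  mark := 54
  block₀ := 702238623167624528953565580257144650680120986535631378086495998239617087515070580766792839103438060802867205743808783865051494550255735547277140549801495235644014335380179665903701932967438055152090315405732765914147124283776101768394764635994768679411515145797484871816686357432093579214440592774982736037545200097267398379701901394275814617017893131356829138072809582125308852908676254278882200535713913768570337985587227378143733681698469482165985704740362716150853602023596092687382071776690537494326059724570774159208056864
  block₁ := 702238623167624528953565580257144650680120986535631378086495998239617087515070580766792839103438060802867205743808783865051494551741263385302076872771967018108123971048969345416254852662865136539859656842198723581971528135525053768096058877755122986616527505475849771885033774667805116607236740541812888589700703991484782344910074714603963127769765209742859406944977387855519745547373361126270729146815831963654572783811479569611965044272503140555457469914279978065301555239453756444945888816157767620536505499703897119407573024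

theorem check_blockData23 : blockData23.check 23 = true := by decide +kernel

/-- A block system over 24 letters. -/
def blockData24 : BlockData where
  len := 396
  window := 14
  perm := 89174674060049392518589896407530027
  period := 557413115796232510517349126210106441
  cycles := [9, 13]
  mark := 55
  block₀ := 9210245956187970618551661144614629836949267820600154127101185740923202726297459748653328822282423578245926088308854440200364303405578175934862698768310657406031086112068809066296182682375987944684068409245841271258327161720640015341241512571747909550197439905310615307005636093069508577310642536607932663238588444539591316102812698895649605295001084286849557679571602778720359467290622690125023007266433587712543448960850149635316286046278336309970255681548697844584778830535012218768586742025941735817083913970509058924811752532539252571718850772776994521171404326946720447515557809343348967456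
  block₁ := 9210245956187970618551661144614629836949267820600154127101185740923202726297459748653328822282423578245926088308854440200364303405578175934862698768310723662786688348420723048458290599026501875388121424423090556532895245938014784106676219721047054183485703013531996853221566387493252098694229817918150238825361861142252155079301385817310118892219262520860872028004284417745039881728887767758418787729169913284515924027127906728974128987896465600030331578946232312311778433493149304261115373069459197803390223604207254777779731556707030925470227423275103317467678773877207021872224101089400686624

theorem check_blockData24 : blockData24.check 24 = true := by decide +kernel

/-- A block system over 25 letters. -/
def blockData25 : BlockData where
  len := 408
  window := 14
  perm := 12019809909447936556101984010745918734
  period := 23325807395047178068959122765040916005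
  cycles := [5, 17]
  mark := 60
  block₀ := 36867236118375754435561051439604843613194594281885811549774789043619522217205524240883727353209787256763480781210407239237404863348819931472068209438339822556084780341991309552824977050757194961662487281963540677367139457511117319663237216113402259019615704420997251240026202148520529623584945995534395830818998862364887520066358981500114043665692495824703678784750404417499633427914611065051242838949752350005731711424723880828604645830666497223557510054876331097607947250416661514985323928556241194499586844224757557285202316536948555105168961462739811035606093577753309594666633133631894487661779698787230517280
  block₁ := 36867236118375754435561051439604843613194594281885811549774789043619522217205524240883727353209787256763480781210407239237404863348819931472068209435799353258110011993627866650071133973889201751098578014301313615922949868870595182829679631860789110440026331322643958900530649773644134710910879877695758948434684651335579895647659415153398820770284166517321873308117165806554136284817230811302504238554808378678340713766753068724720645008413347771222200013307732830948598084742405515035682310963020348026048623013189091207813128786684554403763323031688934825745396994262896251489191172397655140615135346655632656416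

theorem check_blockData25 : blockData25.check 25 = true := by decide +kernel

/-- A block system over 26 letters. -/
def blockData26 : BlockData where
  len := 425
  window := 14
  perm := 524055929338995783624895914532893142253
  period := 478865225607736486447011272051261676907
  cycles := [7, 11]
  mark := 61
  block₀ := 1879976207729678092119995819376048390017355346427517981575632878482762090847936688790325973908727415616390253148902147230107725386366316523172984359045874621477236445775622777813564921929367472822392937574256883023574186707844076482854909171826583965422208090671782900091295813061144926741369771151080886238378156244731294384383984677993756524677521628178442760068899858721207879415006703851784567082567420081155721620003720195421379969067515545562537260966587333742222880890456681758431082646771361352179993590349348441915245086446562071046016464999617594555224401257738413531220834142053506663531591929920061525597366875047930901433518112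
  block₁ := 1879976207729678092119995819376048390017355346427517981575632878482762090847936688790325973908727415616390253148902147230107725386366316523172984359045874713825675468699953453588487736008933158920772745577641928724025786679078463300130609873950663000202989795421028446386984891696569262119930301279626631167637713912693219777417281306129053388788998535451561163674862685809733138949126849887348424807165381282391955370856430487051164475552544578443608419027496038775632831287596583610944997501497380791582279249408827072099895826163909966363639120008258687424151968368719580949422671196674233273373977917434870431149351846501970520253237280

theorem check_blockData26 : blockData26.check 26 = true := by decide +kernel

/-- Dejean's conjecture for `15 ≤ n ≤ 26`: there is an infinite word over an `n`-letter
alphabet containing no factor of exponent strictly greater than `n/(n-1)`, i.e. every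
factor having a period `q ≥ 1` has length at most `q·n/(n−1)`. -/
theorem dejean_15_to_26 (n : ℕ) (hn₁ : 15 ≤ n) (hn₂ : n ≤ 26) :
    ∃ w : ℕ → Fin n, ∀ i L q : ℕ, 1 ≤ q → HasPeriodL (wordOf w i L) q →
      (L : ℚ) ≤ (q : ℚ) * n / (n - 1) := by
  interval_cases n
  · exact BlockData.exists_word_of_check check_blockData15
  · exact BlockData.exists_word_of_check check_blockData16
  · exact BlockData.exists_word_of_check check_blockData17
  · exact BlockData.exists_word_of_check check_blockData18
  · exact BlockData.exists_word_of_check check_blockData19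
  · exact BlockData.exists_word_of_check check_blockData20
  · exact BlockData.exists_word_of_check check_blockData21
  · exact BlockData.exists_word_of_check check_blockData22
  · exact BlockData.exists_word_of_check check_blockData23
  · exact BlockData.exists_word_of_check check_blockData24
  · exact BlockData.exists_word_of_check check_blockData25
  · exact BlockData.exists_word_of_check check_blockData26
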